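/- Assume Hypothesis A and that φ is smooth with ∫_{ℝ³} |k|^{2n} φ̂(k) dk < ∞ for all n. Let (x_α(t), ξ_α(t))_{α=1,…,N} on [0,T] be a continuously differentiable solution of either the discrete filament model (ξ_α(t) = x_{α+1}(t) − x_α(t) with cyclic indices, ẋ_α = u_t(x_α)) or the vortex blob model (ẋ_α = u_t(x_α), ξ̇_α^i = ∑_j ∂_j u_t^i(x_α) ξ_α^j), where u_t(x) = ∑_{α=1}^N ∇φ(x − x_α(t)) ∧ ξ_α(t). Then there exist constants c₆, c₇ > 0 depending only on φ such that for all t ∈ [0,T]: |dA/dt| ≤ c₆ H(t)^{1/2} A(t), and at every t at which ξ_α(t) ≠ 0 for all α, |dL/dt| ≤ c₇ H(t)^{1/2} L(t). -/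

import Mathlib

noncomputable section
open MeasureTheory Real Set

/-- Three-dimensional Euclidean space. -/
abbrev E3 := EuclideanSpace ℝ (Fin 3)

/-- The cross product on `ℝ³`. -/
def cross3 (a b : E3) : E3 := WithLp.toLp 2 (crossProduct a b)

/-- The Fourier transform `∫_{ℝ³} e^{i⟨k,x⟩} f(x) dx` of `f : ℝ³ → ℝ`, as a complex number. -/
def fourierInt (f : E3 → ℝ) (k : E3) : ℂ :=
  ∫ x : E3, Complex.exp (Complex.I * ((inner ℝ k x : ℝ) : ℂ)) * (f x : ℂ)

/-- Hypothesis A: `φ` is even, continuous, integrable, its Fourier transform is the real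
nonnegative function `φhat`, and `φhat` satisfies the moment condition (A.4). -/
structure HypA (φ : E3 → ℝ) (φhat : E3 → ℝ) : Prop where
  even : ∀ x, φ (-x) = φ x
  cont : Continuous φ
  integrable : Integrable φ
  fourier_eq : ∀ k, (φhat k : ℂ) = fourierInt φ k
  nonneg : ∀ k, 0 ≤ φhat k
  moment : Integrable (fun k : E3 => (1 + ‖k‖ ^ 2) ^ 2 * φhat k)

/-- The velocity field `u(x) = ∑_α ∇φ(x − x_α) ∧ ξ_α` of a discrete vorticity
configuration `(x_α, ξ_α)`. -/
def discVel (φ : E3 → ℝ) {N : ℕ} (x ξ : Fin N → E3) (p : E3) : E3 :=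
  ∑ α, cross3 (gradient φ (p - x α)) (ξ α)

/-- The energy `H = (1/2) ∑_{α,β} φ(x_α − x_β) ⟨ξ_α, ξ_β⟩`. -/
def discEnergy (φ : E3 → ℝ) {N : ℕ} (x ξ : Fin N → E3) : ℝ :=
  (1 / 2) * ∑ α, ∑ β, φ (x α - x β) * (inner ℝ (ξ α) (ξ β) : ℝ)

/-- The length `L = ∑_α |ξ_α|` of the configuration. -/
def discLength {N : ℕ} (ξ : Fin N → E3) : ℝ := ∑ α, ‖ξ α‖

/-- The quadratic variation `A = ∑_α |ξ_α|²` of the configuration. -/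
def discQuad {N : ℕ} (ξ : Fin N → E3) : ℝ := ∑ α, ‖ξ α‖ ^ 2

/-- The field `Ψ(x) = ∑_α φ(x − x_α) ξ_α`. -/
def discPsi (φ : E3 → ℝ) {N : ℕ} (x ξ : Fin N → E3) (p : E3) : E3 :=
  ∑ α, φ (p - x α) • ξ α

/-- The curl of a vector field on `ℝ³`, computed with `fderiv`. -/
def curl3 (F : E3 → E3) (p : E3) : E3 :=
  !₂[fderiv ℝ F p (EuclideanSpace.single 1 1) 2 - fderiv ℝ F p (EuclideanSpace.single 2 1) 1,
    fderiv ℝ F p (EuclideanSpace.single 2 1) 0 - fderiv ℝ F p (EuclideanSpace.single 0 1) 2,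
    fderiv ℝ F p (EuclideanSpace.single 0 1) 1 - fderiv ℝ F p (EuclideanSpace.single 1 1) 0]

/-- The function `Φ(x) = ⟨Ψ(x), curl Ψ(x)⟩`. -/
def discPhi (φ : E3 → ℝ) {N : ℕ} (x ξ : Fin N → E3) (p : E3) : ℝ :=
  inner ℝ (discPsi φ x ξ p) (curl3 (discPsi φ x ξ) p)

open scoped FourierTransform

/-- A function satisfying Hypothesis A is the cosine transform of its Fourier transform. -/
lemma HypA.eq_integral_cos {φ φhat : E3 → ℝ} (hA : HypA φ φhat) (hint : Integrable φhat) (x : E3) :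
    φ x = ∫ k : E3, cos (inner ℝ k x) * ((2 * π) ^ 3)⁻¹ * φhat k := by
  set f : E3 → ℂ := fun y => (φ y : ℂ) with hf
  have hfourier : 𝓕 f = fun w => ((φhat ((-(2 * π)) • w) : ℝ) : ℂ) := by
    ext w
    rw [Real.fourier_eq', hA.fourier_eq, fourierInt]
    congr 1
    ext v
    rw [real_inner_smul_left, real_inner_comm, smul_eq_mul]
    congr 2
    push_cast
    ring
  have hne : (-(2 * π)) ≠ 0 := by simp [pi_ne_zero]
  have hfint : Integrable (𝓕 f) := by
    rw [hfourier]
    exact (hint.comp_smul hne).ofReal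
  have hinv : 𝓕⁻ (𝓕 f) x = f x :=
    hA.integrable.ofReal.fourierInv_fourier_eq hfint
      (Complex.continuous_ofReal.comp hA.cont).continuousAt
  set G : E3 → ℂ := fun k => Complex.exp (((-inner ℝ k x : ℝ) : ℂ) * Complex.I) * (φhat k : ℂ)
    with hG
  have hscale : 𝓕⁻ (𝓕 f) x = ((((2 * π) ^ 3)⁻¹ : ℝ) : ℂ) * ∫ k, G k := by
    rw [Real.fourierInv_eq']
    have := Measure.integral_comp_smul (volume : Measure E3) G (-(2 * π))
    rw [finrank_euclideanSpace_fin, Complex.real_smul] at this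
    have habs : |((-(2 * π)) ^ 3)⁻¹| = ((2 * π) ^ 3)⁻¹ := by
      rw [abs_inv, abs_pow, abs_neg, abs_of_pos two_pi_pos]
    rw [habs] at this
    rw [← this, hfourier]
    congr 1
    ext v
    simp only [hG, real_inner_smul_left, smul_eq_mul]
    congr 3
    push_cast
    ring
  have hGint : Integrable G := by
    refine hint.ofReal.bdd_mul (c := 1) (by fun_prop) (Filter.Eventually.of_forall fun k => ?_)
    rw [Complex.norm_exp_ofReal_mul_I]
  have hre : φ x = ((2 * π) ^ 3)⁻¹ * ∫ k, (G k).re := by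
    have h1 : φ x = (f x).re := by simp [hf]
    have h2 : ∫ k, (G k).re = (∫ k, G k).re := integral_re hGint
    rw [h1, ← hinv, hscale, Complex.re_ofReal_mul, h2]
  rw [hre, ← integral_const_mul]
  congr 1
  ext k
  simp only [hG, Complex.re_mul_ofReal, Complex.exp_ofReal_mul_I_re, cos_neg]
  ring

lemma integrable_norm_mul_of_moment {g : E3 → ℝ} (hg0 : ∀ k, 0 ≤ g k) (hg : Integrable g)
    (hg2 : Integrable fun k => ‖k‖ ^ 2 * g k) : Integrable fun k => ‖k‖ * g k := by
  refine (hg.add hg2).mono' (by fun_prop) (Filter.Eventually.of_forall fun k => ?_)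
  rw [norm_of_nonneg (mul_nonneg (norm_nonneg k) (hg0 k)), Pi.add_apply]
  nlinarith [mul_nonneg (sq_nonneg (‖k‖ - 1)) (hg0 k), mul_nonneg (sq_nonneg ‖k‖) (hg0 k), hg0 k]

lemma norm_inner_mul_sin_mul_le {r : ℝ} (hr : 0 ≤ r) (k e : E3) (s : ℝ) :
    ‖-(inner ℝ k e * sin s * r)‖ ≤ ‖e‖ * (‖k‖ * r) := by
  rw [norm_neg, norm_mul, norm_mul, norm_of_nonneg hr, ← mul_assoc]
  refine mul_le_mul_of_nonneg_right ?_ hr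
  calc ‖(inner ℝ k e : ℝ)‖ * ‖sin s‖ ≤ (‖k‖ * ‖e‖) * 1 :=
        mul_le_mul (norm_inner_le_norm k e) (abs_sin_le_one _) (norm_nonneg _) (by positivity)
    _ = ‖e‖ * ‖k‖ := by ring

lemma integrable_inner_mul_sin {g : E3 → ℝ} (hg0 : ∀ k, 0 ≤ g k) (hg : Integrable g)
    (hg1 : Integrable fun k => ‖k‖ * g k) (x e : E3) :
    Integrable fun k => -(inner ℝ k e * sin (inner ℝ k x) * g k) := by
  refine (hg1.const_mul ‖e‖).mono' (by fun_prop)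
    (Filter.Eventually.of_forall fun k => norm_inner_mul_sin_mul_le (hg0 k) _ _ _)

/-- Differentiation of a cosine transform under the integral sign. -/
lemma inner_gradient_eq_integral_sin {φ g : E3 → ℝ} (hφ : Differentiable ℝ φ)
    (hg0 : ∀ k, 0 ≤ g k) (hg : Integrable g) (hg1 : Integrable fun k => ‖k‖ * g k)
    (hrep : ∀ x, φ x = ∫ k, cos (inner ℝ k x) * g k) (x e : E3) :
    inner ℝ (gradient φ x) e = ∫ k, -(inner ℝ k e * sin (inner ℝ k x) * g k) := by
  have hline : HasDerivAt (fun t : ℝ => φ (x + t • e)) (inner ℝ (gradient φ x) e) 0 := by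
    have h1 : HasDerivAt (fun t : ℝ => x + t • e) e 0 := by
      simpa using ((hasDerivAt_id (0 : ℝ)).smul_const e).const_add x
    have h2 : HasFDerivAt φ (fderiv ℝ φ x) (x + (0 : ℝ) • e) := by
      simpa using (hφ x).hasFDerivAt
    have h3 := h2.comp_hasDerivAt (0 : ℝ) h1
    rwa [← inner_gradient_left] at h3
  have hpar : HasDerivAt (fun t : ℝ => ∫ k, cos (inner ℝ k (x + t • e)) * g k)
      (∫ k, -(inner ℝ k e * sin (inner ℝ k (x + (0 : ℝ) • e)) * g k)) 0 := by
    refine (hasDerivAt_integral_of_dominated_loc_of_deriv_le (s := univ)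
      (F' := fun t k => -(inner ℝ k e * sin (inner ℝ k (x + t • e)) * g k))
      (bound := fun k => ‖e‖ * (‖k‖ * g k)) Filter.univ_mem
      (Filter.Eventually.of_forall fun t => by fun_prop) ?_ (by fun_prop) ?_
      (hg1.const_mul _) ?_).2
    · refine hg.bdd_mul (c := 1) (by fun_prop) (Filter.Eventually.of_forall fun k => ?_)
      exact abs_cos_le_one _
    · exact Filter.Eventually.of_forall fun k t _ => norm_inner_mul_sin_mul_le (hg0 k) _ _ _
    · refine Filter.Eventually.of_forall fun k t _ => ?_
      have h1 : HasDerivAt (fun t : ℝ => inner ℝ k (x + t • e)) (inner ℝ k e) t := by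
        simp only [inner_add_right, real_inner_smul_right]
        simpa using ((hasDerivAt_id t).mul_const (inner ℝ k e)).const_add (inner ℝ k x)
      exact (h1.cos.mul_const (g k)).congr_deriv (by ring)
  simp only [← hrep] at hpar
  simpa using hline.unique hpar

lemma inner_cross3_left (a b c : E3) : inner ℝ (cross3 a b) c = inner ℝ a (cross3 b c) := by
  simp [cross3, PiLp.inner_apply, Fin.sum_univ_three, crossProduct]
  ring

lemma norm_cross3_le (a b : E3) : ‖cross3 a b‖ ≤ ‖a‖ * ‖b‖ := by
  rw [cross3, InnerProductGeometry.norm_ofLp_crossProduct]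
  exact mul_le_of_le_one_right (by positivity) (sin_le_one _)

/-- The cosine mode `∑_α cos⟨k, x_α⟩ ξ_α` of a configuration. -/
def cosMode {N : ℕ} (x ξ : Fin N → E3) (k : E3) : E3 := ∑ α, cos (inner ℝ k (x α)) • ξ α

/-- The sine mode `∑_α sin⟨k, x_α⟩ ξ_α` of a configuration. -/
def sinMode {N : ℕ} (x ξ : Fin N → E3) (k : E3) : E3 := ∑ α, sin (inner ℝ k (x α)) • ξ α

lemma norm_cosMode_le {N : ℕ} (x ξ : Fin N → E3) (k : E3) : ‖cosMode x ξ k‖ ≤ discLength ξ := by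
  refine (norm_sum_le _ _).trans (Finset.sum_le_sum fun α _ => ?_)
  rw [norm_smul]
  exact mul_le_of_le_one_left (norm_nonneg _) (abs_cos_le_one _)

lemma norm_sinMode_le {N : ℕ} (x ξ : Fin N → E3) (k : E3) : ‖sinMode x ξ k‖ ≤ discLength ξ := by
  refine (norm_sum_le _ _).trans (Finset.sum_le_sum fun α _ => ?_)
  rw [norm_smul]
  exact mul_le_of_le_one_left (norm_nonneg _) (abs_sin_le_one _)

lemma continuous_cosMode {N : ℕ} (x ξ : Fin N → E3) : Continuous (cosMode x ξ) := by
  unfold cosMode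
  fun_prop

lemma continuous_sinMode {N : ℕ} (x ξ : Fin N → E3) : Continuous (sinMode x ξ) := by
  unfold sinMode
  fun_prop

/-- The energy in terms of the Fourier modes of the configuration. -/
lemma two_mul_discEnergy_eq {φ g : E3 → ℝ} (hg : Integrable g)
    (hrep : ∀ x, φ x = ∫ k, cos (inner ℝ k x) * g k) {N : ℕ} (x ξ : Fin N → E3) :
    2 * discEnergy φ x ξ =
      ∫ k, (‖cosMode x ξ k‖ ^ 2 + ‖sinMode x ξ k‖ ^ 2) * g k := by
  have hint : ∀ α β, Integrable fun k =>
      cos (inner ℝ k (x α - x β)) * g k * (inner ℝ (ξ α) (ξ β) : ℝ) := fun α β =>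
    (hg.bdd_mul (c := 1) (by fun_prop)
      (Filter.Eventually.of_forall fun k => abs_cos_le_one _)).mul_const _
  have hsum : 2 * discEnergy φ x ξ = ∫ k, ∑ α, ∑ β,
      cos (inner ℝ k (x α - x β)) * g k * (inner ℝ (ξ α) (ξ β) : ℝ) := by
    rw [integral_finsetSum _ fun α _ => integrable_finsetSum _ fun β _ => hint α β, discEnergy,
      ← mul_assoc]
    norm_num
    refine Finset.sum_congr rfl fun α _ => ?_
    rw [integral_finsetSum _ fun β _ => hint α β]
    refine Finset.sum_congr rfl fun β _ => ?_
    rw [integral_mul_const, hrep]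
  rw [hsum]
  congr 1
  ext k
  rw [← real_inner_self_eq_norm_sq, ← real_inner_self_eq_norm_sq]
  simp only [cosMode, sinMode, sum_inner, inner_sum, real_inner_smul_left, real_inner_smul_right,
    ← Finset.sum_add_distrib, Finset.sum_mul]
  refine Finset.sum_congr rfl fun α _ => Finset.sum_congr rfl fun β _ => ?_
  rw [inner_sub_right, cos_sub, real_inner_comm (ξ α) (ξ β)]
  ring

/-- Cauchy–Schwarz inequality for a nonnegative weight. -/
lemma integral_mul_le_sqrt_mul_sqrt {X : Type*} [MeasurableSpace X] {μ : Measure X}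
    {g a b : X → ℝ} (hg0 : ∀ k, 0 ≤ g k)
    (haa : Integrable (fun k => a k ^ 2 * g k) μ) (hab : Integrable (fun k => a k * b k * g k) μ)
    (hbb : Integrable (fun k => b k ^ 2 * g k) μ) :
    ∫ k, a k * b k * g k ∂μ ≤ √(∫ k, a k ^ 2 * g k ∂μ) * √(∫ k, b k ^ 2 * g k ∂μ) := by
  have hA : 0 ≤ ∫ k, a k ^ 2 * g k ∂μ :=
    integral_nonneg fun k => mul_nonneg (sq_nonneg _) (hg0 k)
  have hdisc := discrim_le_zero (a := ∫ k, a k ^ 2 * g k ∂μ) (b := 2 * ∫ k, a k * b k * g k ∂μ)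
    (c := ∫ k, b k ^ 2 * g k ∂μ) fun t => by
      have : 0 ≤ ∫ k, (t * a k + b k) ^ 2 * g k ∂μ :=
        integral_nonneg fun k => mul_nonneg (sq_nonneg _) (hg0 k)
      have heq : ∫ k, (t * a k + b k) ^ 2 * g k ∂μ =
          ∫ k, (t * t) * (a k ^ 2 * g k) + (2 * t) * (a k * b k * g k) + b k ^ 2 * g k ∂μ := by
        congr 1
        ext k
        ring
      have hquad : Integrable (fun k => (t * t) * (a k ^ 2 * g k) +
          (2 * t) * (a k * b k * g k)) μ := (haa.const_mul _).add (hab.const_mul _)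
      rw [heq, integral_add hquad hbb, integral_add (haa.const_mul _) (hab.const_mul _),
        integral_const_mul,
        integral_const_mul] at this
      linarith
  rw [discrim] at hdisc
  rw [← sqrt_mul hA]
  exact le_sqrt_of_sq_le (by linarith)

/-- The total size of the Fourier modes of a configuration. -/
def modeNorm {N : ℕ} (x ξ : Fin N → E3) (k : E3) : ℝ := ‖cosMode x ξ k‖ + ‖sinMode x ξ k‖

lemma continuous_modeNorm {N : ℕ} (x ξ : Fin N → E3) : Continuous (modeNorm x ξ) :=
  (continuous_cosMode x ξ).norm.add (continuous_sinMode x ξ).norm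

lemma modeNorm_nonneg {N : ℕ} (x ξ : Fin N → E3) (k : E3) : 0 ≤ modeNorm x ξ k :=
  add_nonneg (norm_nonneg _) (norm_nonneg _)

lemma modeNorm_le {N : ℕ} (x ξ : Fin N → E3) (k : E3) : modeNorm x ξ k ≤ 2 * discLength ξ := by
  rw [modeNorm]
  linarith [norm_cosMode_le x ξ k, norm_sinMode_le x ξ k]

lemma integrable_sq_mul_modeNorm_mul {g : E3 → ℝ} (hg2 : Integrable fun k => ‖k‖ ^ 2 * g k)
    {N : ℕ} (x ξ : Fin N → E3) : Integrable fun k => ‖k‖ ^ 2 * modeNorm x ξ k * g k := by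
  refine (hg2.bdd_mul (c := 2 * discLength ξ) (continuous_modeNorm x ξ).aestronglyMeasurable
    (Filter.Eventually.of_forall fun k => ?_)).congr
    (Filter.Eventually.of_forall fun k => by ring)
  rw [norm_of_nonneg (modeNorm_nonneg x ξ k)]
  exact modeNorm_le x ξ k

lemma integrable_modeNorm_sq_mul {g : E3 → ℝ} (hg : Integrable g) {N : ℕ} (x ξ : Fin N → E3) :
    Integrable fun k => modeNorm x ξ k ^ 2 * g k := by
  refine hg.bdd_mul (c := (2 * discLength ξ) ^ 2)
    ((continuous_modeNorm x ξ).pow 2).aestronglyMeasurable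
    (Filter.Eventually.of_forall fun k => ?_)
  rw [norm_pow, norm_of_nonneg (modeNorm_nonneg x ξ k)]
  exact pow_le_pow_left₀ (modeNorm_nonneg x ξ k) (modeNorm_le x ξ k) 2

lemma sqrt_integral_modeNorm_sq_le {φ g : E3 → ℝ} (hg0 : ∀ k, 0 ≤ g k) (hg : Integrable g)
    (hrep : ∀ x, φ x = ∫ k, cos (inner ℝ k x) * g k) {N : ℕ} (x ξ : Fin N → E3) :
    √(∫ k, modeNorm x ξ k ^ 2 * g k) ≤ 2 * √(discEnergy φ x ξ) := by
  have hmm := integrable_modeNorm_sq_mul hg x ξ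
  have hmodes : Integrable fun k => (‖cosMode x ξ k‖ ^ 2 + ‖sinMode x ξ k‖ ^ 2) * g k := by
    refine hg.bdd_mul (c := 2 * discLength ξ ^ 2)
      (((continuous_cosMode x ξ).norm.pow 2).add
        ((continuous_sinMode x ξ).norm.pow 2)).aestronglyMeasurable
      (Filter.Eventually.of_forall fun k => ?_)
    rw [norm_of_nonneg (by positivity), two_mul]
    gcongr
    exacts [norm_cosMode_le x ξ k, norm_sinMode_le x ξ k]
  have h : ∫ k, modeNorm x ξ k ^ 2 * g k ≤ 2 ^ 2 * discEnergy φ x ξ := by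
    calc ∫ k, modeNorm x ξ k ^ 2 * g k
        ≤ ∫ k, 2 * ((‖cosMode x ξ k‖ ^ 2 + ‖sinMode x ξ k‖ ^ 2) * g k) := by
          refine integral_mono hmm (hmodes.const_mul 2) fun k => ?_
          simp only [modeNorm]
          nlinarith [mul_nonneg (sq_nonneg (‖cosMode x ξ k‖ - ‖sinMode x ξ k‖)) (hg0 k)]
      _ = 2 ^ 2 * discEnergy φ x ξ := by
          rw [integral_const_mul, ← two_mul_discEnergy_eq hg hrep]
          ring
  refine (sqrt_le_sqrt h).trans_eq ?_
  rw [sqrt_mul (by norm_num), sqrt_sq (by norm_num)]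

lemma inner_discVel_sub_le {φ g : E3 → ℝ} (hφ : Differentiable ℝ φ)
    (hg0 : ∀ k, 0 ≤ g k) (hg : Integrable g) (hg2 : Integrable fun k => ‖k‖ ^ 2 * g k)
    (hrep : ∀ x, φ x = ∫ k, cos (inner ℝ k x) * g k) {N : ℕ} (x ξ : Fin N → E3) (p q z : E3) :
    inner ℝ (discVel φ x ξ p - discVel φ x ξ q) z ≤
      ‖z‖ * ‖p - q‖ * ∫ k, ‖k‖ ^ 2 * modeNorm x ξ k * g k := by
  have hg1 := integrable_norm_mul_of_moment hg0 hg hg2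
  have hkm := integrable_sq_mul_modeNorm_mul hg2 x ξ
  have hint : ∀ (y : E3) α, Integrable fun k =>
      -(inner ℝ k (cross3 (ξ α) z) * sin (inner ℝ k (y - x α)) * g k) := fun y α =>
    integrable_inner_mul_sin hg0 hg hg1 _ _
  have hvel : ∀ y : E3, inner ℝ (discVel φ x ξ y) z =
      ∫ k, ∑ α, -(inner ℝ k (cross3 (ξ α) z) * sin (inner ℝ k (y - x α)) * g k) := by
    intro y
    rw [integral_finsetSum _ fun α _ => hint y α, discVel, sum_inner]
    refine Finset.sum_congr rfl fun α _ => ?_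
    rw [inner_cross3_left, inner_gradient_eq_integral_sin hφ hg0 hg hg1 hrep]
  have hmode : ∀ y k : E3,
      ∑ α, -(inner ℝ k (cross3 (ξ α) z) * sin (inner ℝ k (y - x α)) * g k) =
      -(inner ℝ (cross3 z k) (sin (inner ℝ k y) • cosMode x ξ k -
        cos (inner ℝ k y) • sinMode x ξ k) * g k) := by
    intro y k
    simp only [cosMode, sinMode, inner_sub_right, real_inner_smul_right, inner_sum,
      Finset.mul_sum, ← Finset.sum_sub_distrib, Finset.sum_mul, ← Finset.sum_neg_distrib]
    refine Finset.sum_congr rfl fun α _ => ?_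
    rw [sin_sub, real_inner_comm (cross3 (ξ α) z) k, inner_cross3_left,
      real_inner_comm (cross3 z k)]
    ring
  rw [inner_sub_left, hvel p, hvel q,
    ← integral_sub (integrable_finsetSum _ fun α _ => hint p α)
      (integrable_finsetSum _ fun α _ => hint q α), ← integral_const_mul]
  refine integral_mono ((integrable_finsetSum _ fun α _ => hint p α).sub
    (integrable_finsetSum _ fun α _ => hint q α)) (hkm.const_mul _) fun k => ?_
  simp only [hmode]
  set w : E3 := (sin (inner ℝ k q) - sin (inner ℝ k p)) • cosMode x ξ k -
    (cos (inner ℝ k q) - cos (inner ℝ k p)) • sinMode x ξ k with hw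
  have hkpq : |(inner ℝ k q : ℝ) - inner ℝ k p| ≤ ‖k‖ * ‖p - q‖ := by
    rw [← inner_sub_right, norm_sub_rev p q]
    exact abs_real_inner_le_norm _ _
  have hwle : ‖w‖ ≤ ‖k‖ * ‖p - q‖ * modeNorm x ξ k := by
    refine (norm_sub_le _ _).trans ?_
    rw [norm_smul, norm_smul, modeNorm, mul_add]
    gcongr
    · exact (abs_sin_sub_sin_le _ _).trans hkpq
    · exact (abs_cos_sub_cos_le _ _).trans hkpq
  calc _ = inner ℝ (cross3 z k) w * g k := by
        simp only [hw, inner_sub_right, real_inner_smul_right]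
        ring
    _ ≤ (‖z‖ * ‖k‖) * (‖k‖ * ‖p - q‖ * modeNorm x ξ k) * g k := by
        refine mul_le_mul_of_nonneg_right ((real_inner_le_norm _ _).trans ?_) (hg0 k)
        exact mul_le_mul (norm_cross3_le z k) hwle (norm_nonneg _) (by positivity)
    _ = _ := by ring

/-- The velocity field is Lipschitz with constant controlled by the square root of the energy. -/
lemma norm_discVel_sub_le {φ g : E3 → ℝ} (hφ : Differentiable ℝ φ)
    (hg0 : ∀ k, 0 ≤ g k) (hg : Integrable g) (hg2 : Integrable fun k => ‖k‖ ^ 2 * g k)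
    (hg4 : Integrable fun k => (‖k‖ ^ 2) ^ 2 * g k)
    (hrep : ∀ x, φ x = ∫ k, cos (inner ℝ k x) * g k) {N : ℕ} (x ξ : Fin N → E3) (p q : E3) :
    ‖discVel φ x ξ p - discVel φ x ξ q‖ ≤
      2 * √(∫ k, (‖k‖ ^ 2) ^ 2 * g k) * √(discEnergy φ x ξ) * ‖p - q‖ := by
  have hI : ∫ k, ‖k‖ ^ 2 * modeNorm x ξ k * g k ≤
      √(∫ k, (‖k‖ ^ 2) ^ 2 * g k) * (2 * √(discEnergy φ x ξ)) :=
    (integral_mul_le_sqrt_mul_sqrt hg0 hg4 (integrable_sq_mul_modeNorm_mul hg2 x ξ)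
      (integrable_modeNorm_sq_mul hg x ξ)).trans
      (mul_le_mul_of_nonneg_left (sqrt_integral_modeNorm_sq_le hg0 hg hrep x ξ) (sqrt_nonneg _))
  have hpair := inner_discVel_sub_le hφ hg0 hg hg2 hrep x ξ p q
    (discVel φ x ξ p - discVel φ x ξ q)
  rw [real_inner_self_eq_norm_mul_norm, mul_assoc] at hpair
  have hrhs : 0 ≤ 2 * √(∫ k, (‖k‖ ^ 2) ^ 2 * g k) * √(discEnergy φ x ξ) * ‖p - q‖ :=
    mul_nonneg (mul_nonneg (mul_nonneg two_pos.le (sqrt_nonneg _)) (sqrt_nonneg _)) (norm_nonneg _)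
  rcases (norm_nonneg (discVel φ x ξ p - discVel φ x ξ q)).eq_or_lt with h | h
  · exact h.symm.trans_le hrhs
  · refine ((le_of_mul_le_mul_left hpair h).trans
      (mul_le_mul_of_nonneg_left hI (norm_nonneg _))).trans_eq ?_
    ring

lemma HasDerivAt.norm_of_ne_zero {F : Type*} [NormedAddCommGroup F] [InnerProductSpace ℝ F]
    {f : ℝ → F} {f' : F} {t : ℝ}
    (hf : HasDerivAt f f' t) (h0 : f t ≠ 0) :
    HasDerivAt (fun s => ‖f s‖) (Inner.inner ℝ (f t) f' / ‖f t‖) t := by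
  have h := hf.norm_sq.sqrt (by simpa using h0)
  simp only [sqrt_sq (norm_nonneg _)] at h
  exact h.congr_deriv (by field_simp)

/-- Rate bounds for the length and the quadratic variation along solutions of
either the discrete filament model or the vortex blob model:
`|dA/dt| ≤ c₆ H^{1/2} A`, and `|dL/dt| ≤ c₇ H^{1/2} L` whenever all `ξ_α(t) ≠ 0`,
with `c₆, c₇` depending only on `φ`. -/
theorem discrete_length_quad_rate (φ φhat : E3 → ℝ) (hA : HypA φ φhat)
    (hsm : ContDiff ℝ (⊤ : ℕ∞) φ)
    (hmom : ∀ n : ℕ, Integrable (fun k : E3 => ‖k‖ ^ (2 * n) * φhat k)) :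
    ∃ c₆ c₇ : ℝ, 0 < c₆ ∧ 0 < c₇ ∧
      ∀ (N : ℕ), 0 < N → ∀ (T : ℝ), 0 < T → ∀ x ξ : Fin N → ℝ → E3,
        (∀ α, ContDiff ℝ 1 (x α)) → (∀ α, ContDiff ℝ 1 (ξ α)) →
        (∀ t ∈ Icc (0:ℝ) T, ∀ α,
          HasDerivAt (x α)
            (discVel φ (fun β => x β t) (fun β => ξ β t) (x α t)) t) →
        -- either the discrete filament model or the vortex blob model
        ((∀ t : ℝ, ∀ α, ξ α t = x (finRotate N α) t - x α t) ∨
          (∀ t ∈ Icc (0:ℝ) T, ∀ α,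
            HasDerivAt (ξ α)
              (fderiv ℝ (discVel φ (fun β => x β t) (fun β => ξ β t)) (x α t)
                (ξ α t)) t)) →
        ∀ t ∈ Icc (0:ℝ) T,
          (∃ a' : ℝ,
            HasDerivAt (fun s => discQuad (fun β => ξ β s)) a' t ∧
            |a'| ≤ c₆ * Real.sqrt (discEnergy φ (fun β => x β t) (fun β => ξ β t)) *
              discQuad (fun β => ξ β t)) ∧
          ((∀ α, ξ α t ≠ 0) →
            ∃ l' : ℝ,
              HasDerivAt (fun s => discLength (fun β => ξ β s)) l' t ∧
              |l'| ≤ c₇ * Real.sqrt (discEnergy φ (fun β => x β t) (fun β => ξ β t)) *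
                discLength (fun β => ξ β t)) := by
  set g : E3 → ℝ := fun k => ((2 * π) ^ 3)⁻¹ * φhat k with hgdef
  have hg0 : ∀ k, 0 ≤ g k := fun k => mul_nonneg (by positivity) (hA.nonneg k)
  have hφhat : Integrable φhat := by simpa using hmom 0
  have hg : Integrable g := hφhat.const_mul _
  have hg2 : Integrable fun k => ‖k‖ ^ 2 * g k :=
    ((hmom 1).const_mul ((2 * π) ^ 3)⁻¹).congr
      (Filter.Eventually.of_forall fun k => by simp only [hgdef]; ring)
  have hg4 : Integrable fun k => (‖k‖ ^ 2) ^ 2 * g k :=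
    ((hmom 2).const_mul ((2 * π) ^ 3)⁻¹).congr
      (Filter.Eventually.of_forall fun k => by simp only [hgdef]; ring)
  have hrep : ∀ x, φ x = ∫ k, cos (inner ℝ k x) * g k := fun x => by
    rw [hA.eq_integral_cos hφhat x]
    simp only [hgdef, mul_assoc]
  have hφ : Differentiable ℝ φ := hsm.differentiable (by simp)
  set C : ℝ := 2 * √(∫ k, (‖k‖ ^ 2) ^ 2 * g k) + 1
  have hCpos : 0 < C := by positivity
  refine ⟨2 * C, C, by positivity, hCpos, ?_⟩
  intro N _ T _ x ξ _ _ hx hmodel t ht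
  set h := √(discEnergy φ (fun β => x β t) (fun β => ξ β t))
  have hh : 0 ≤ h := sqrt_nonneg _
  have hlip : ∀ p q, ‖discVel φ (fun β => x β t) (fun β => ξ β t) p -
      discVel φ (fun β => x β t) (fun β => ξ β t) q‖ ≤ C * h * ‖p - q‖ := fun p q => by
    refine (norm_discVel_sub_le hφ hg0 hg hg2 hg4 hrep _ _ p q).trans ?_
    gcongr
    linarith
  have hξ : ∀ α, ∃ v, HasDerivAt (ξ α) v t ∧ ‖v‖ ≤ C * h * ‖ξ α t‖ := by
    intro α
    rcases hmodel with hfil | hblob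
    · refine ⟨_, ((hx t ht (finRotate N α)).sub (hx t ht α)).congr_of_eventuallyEq
        (Filter.Eventually.of_forall fun s => hfil s α), ?_⟩
      conv_rhs => rw [hfil t α]
      exact hlip _ _
    · refine ⟨_, hblob t ht α, ?_⟩
      refine (ContinuousLinearMap.le_opNorm _ _).trans ?_
      gcongr
      exact norm_fderiv_le_of_lip' ℝ (by positivity) (Filter.Eventually.of_forall fun y => hlip y _)
  choose v hv hvle using hξ
  have hinner : ∀ α, |(inner ℝ (ξ α t) (v α) : ℝ)| ≤ C * h * ‖ξ α t‖ ^ 2 := fun α =>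
    calc |(inner ℝ (ξ α t) (v α) : ℝ)| ≤ ‖ξ α t‖ * ‖v α‖ := abs_real_inner_le_norm _ _
      _ ≤ ‖ξ α t‖ * (C * h * ‖ξ α t‖) := by gcongr; exact hvle α
      _ = C * h * ‖ξ α t‖ ^ 2 := by ring
  refine ⟨⟨_, HasDerivAt.fun_sum fun α _ => (hv α).norm_sq, ?_⟩, fun hne =>
    ⟨_, HasDerivAt.fun_sum fun α _ => (hv α).norm_of_ne_zero (hne α), ?_⟩⟩
  · rw [discQuad, Finset.mul_sum]
    refine (Finset.abs_sum_le_sum_abs _ _).trans (Finset.sum_le_sum fun α _ => ?_)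
    rw [abs_mul, abs_two]
    linarith [hinner α]
  · rw [discLength, Finset.mul_sum]
    refine (Finset.abs_sum_le_sum_abs _ _).trans (Finset.sum_le_sum fun α _ => ?_)
    have hpos : 0 < ‖ξ α t‖ := norm_pos_iff.2 (hne α)
    rw [abs_div, abs_norm, div_le_iff₀ hpos]
    linarith [hinner α]
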